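/- arXiv:cs/0601089 — 2 statements merged into one kernel-verified Lean document; each statement's English description precedes it below -/
import Mathlib

section
/- Let H be a Hilbert space and C1, C2 two closed affine subspaces of H with nonempty intersection C. The alternating projection sequence x_0 = x̂, x_{n} obtained by alternately projecting onto C1 and C2 converges in norm to P_C(x̂), the projection of x̂ onto C. -/
open Filter Topology

open scoped RealInnerProductSpace

/-- A point of an affine subspace nearest to `v` differs from `v` by a vector orthogonal to
the direction of the subspace. -/
theorem AffineSubspace.inner_sub_eq_zero_of_forall_norm_le
    {H : Type*} [NormedAddCommGroup H] [InnerProductSpace ℝ H] {A : AffineSubspace ℝ H} {v p : H}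
    (hp : p ∈ A) (hmin : ∀ w ∈ A, ‖p - v‖ ≤ ‖w - v‖) {d : H} (hd : d ∈ A.direction) :
    ⟪v - p, d⟫ = 0 := by
  have key : ∀ t : ℝ, 0 ≤ ‖d‖ ^ 2 * (t * t) + 2 * ⟪p - v, d⟫ * t + 0 := by
    intro t
    have hle := hmin (t • d + p) (A.vadd_mem_of_mem_direction (A.direction.smul_mem t hd) hp)
    have hsq : ‖p - v‖ ^ 2 ≤ ‖p - v + t • d‖ ^ 2 := by
      rw [show p - v + t • d = t • d + p - v by abel]
      gcongr
    rw [norm_add_sq_real, real_inner_smul_right, norm_smul, mul_pow, Real.norm_eq_abs, sq_abs]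
      at hsq
    nlinarith
  have hdiscrim := discrim_le_zero key
  have hzero : ⟪p - v, d⟫ = 0 := by
    rw [discrim] at hdiscrim
    nlinarith [sq_nonneg ⟪p - v, d⟫]
  rw [← neg_sub p v, inner_neg_left, hzero, neg_zero]

section AlternatingProjections

variable {H : Type*} [NormedAddCommGroup H] [InnerProductSpace ℝ H]
  {W : ℕ → Submodule ℝ H} {y : ℕ → H}

theorem alternating_period (hW : ∀ n, W (n + 2) = W n) (n k : ℕ) : W (n + 2 * k) = W n := by
  induction k with
  | zero => rfl
  | succ k ih => rw [← ih, ← hW (n + 2 * k)]; rfl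

/-- The terms of an alternating projection sequence lie in the expected subspaces. -/
theorem alternating_mem (hW : ∀ n, W (n + 2) = W n) (hmem : ∀ n, y (n + 1) ∈ W n) (n k : ℕ) :
    y (n + 2 * k + 1) ∈ W n :=
  alternating_period hW n k ▸ hmem (n + 2 * k)

theorem alternating_norm_sub_sq (hmem : ∀ n, y (n + 1) ∈ W n)
    (horth : ∀ n, ∀ w ∈ W n, ⟪y n - y (n + 1), w⟫ = 0) (n : ℕ) :
    ‖y n - y (n + 1)‖ ^ 2 = ‖y n‖ ^ 2 - ‖y (n + 1)‖ ^ 2 := by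
  have h := horth n _ (hmem n)
  rw [inner_sub_left, real_inner_self_eq_norm_sq] at h
  rw [norm_sub_sq_real]
  linarith

theorem alternating_inner_eq_norm_sq (hW : ∀ n, W (n + 2) = W n)
    (hmem : ∀ n, y (n + 1) ∈ W n)
    (horth : ∀ n, ∀ w ∈ W n, ⟪y n - y (n + 1), w⟫ = 0) (j d : ℕ) :
    ⟪y (j + 1), y (j + 2 * d + 1)⟫ = ‖y (j + d + 1)‖ ^ 2 := by
  induction d generalizing j with
  | zero => exact real_inner_self_eq_norm_sq _
  | succ d ih =>
    have hj : y (j + 1) ∈ W (j + 2 * (d + 1)) :=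
      (alternating_period hW j (d + 1)).symm ▸ hmem j
    have hleft := horth _ _ hj
    have hright := horth _ _ (alternating_mem hW hmem (j + 1) d)
    have ih' := ih (j + 1)
    rw [inner_sub_left, sub_eq_zero] at hleft hright
    rw [show j + 2 * (d + 1) = j + 1 + 2 * d + 1 by ring] at hleft ⊢
    rw [real_inner_comm, ← hleft, real_inner_comm, hright, ih',
      show j + 1 + d + 1 = j + (d + 1) + 1 by ring]

/-- An alternating projection sequence between two closed subspaces, started orthogonally to
their intersection, tends to zero. -/
theorem alternating_tendsto_zero [CompleteSpace H] (hW : ∀ n, W (n + 2) = W n)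
    (hclosed : ∀ n, IsClosed (W n : Set H)) (hmem : ∀ n, y (n + 1) ∈ W n)
    (horth : ∀ n, ∀ w ∈ W n, ⟪y n - y (n + 1), w⟫ = 0)
    (hstart : ∀ w, (∀ n, w ∈ W n) → ⟪y 0, w⟫ = 0) :
    Tendsto y atTop (𝓝 0) := by
  have hstep := alternating_norm_sub_sq hmem horth
  have hanti : Antitone fun n => ‖y n‖ ^ 2 :=
    antitone_nat_of_succ_le fun n => by linarith [hstep n, sq_nonneg ‖y n - y (n + 1)‖]
  have hbdd : BddBelow (Set.range fun n => ‖y n‖ ^ 2) :=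
    ⟨0, by rintro _ ⟨n, rfl⟩; positivity⟩
  obtain ⟨L, hL⟩ : ∃ L, Tendsto (fun n => ‖y n‖ ^ 2) atTop (𝓝 L) :=
    ⟨_, tendsto_atTop_ciInf hanti hbdd⟩
  have hLle : ∀ n, L ≤ ‖y n‖ ^ 2 := hanti.le_of_tendsto hL
  have hgap : ∀ j d, ‖y (j + 1) - y (j + 2 * d + 1)‖ ≤ √(‖y (j + 1)‖ ^ 2 - L) := by
    intro j d
    apply Real.le_sqrt_of_sq_le
    rw [norm_sub_sq_real, alternating_inner_eq_norm_sq hW hmem horth]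
    have hd : ‖y (j + 2 * d + 1)‖ ^ 2 ≤ ‖y (j + d + 1)‖ ^ 2 :=
      hanti (by omega : j + d + 1 ≤ j + 2 * d + 1)
    linarith [hLle (j + d + 1)]
  have hsucc : ∀ j k, j ≤ k → ‖y k - y (k + 1)‖ ≤ √(‖y j‖ ^ 2 - L) := by
    intro j k hjk
    apply Real.le_sqrt_of_sq_le
    have hk : ‖y k‖ ^ 2 ≤ ‖y j‖ ^ 2 := hanti hjk
    linarith [hstep k, hLle (k + 1)]
  have hcauchy : CauchySeq fun n => y (n + 1) := by
    refine cauchySeq_of_le_tendsto_0' (fun j => 2 * √(‖y (j + 1)‖ ^ 2 - L)) ?_ ?_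
    · intro j k hjk
      rw [dist_eq_norm]
      obtain ⟨d, rfl | rfl⟩ : ∃ d, k = j + 2 * d ∨ k = j + 2 * d + 1 := ⟨(k - j) / 2, by omega⟩
      · linarith [hgap j d, Real.sqrt_nonneg (‖y (j + 1)‖ ^ 2 - L)]
      · linarith [hgap j d, hsucc (j + 1) (j + 2 * d + 1) (by omega),
          norm_sub_le_norm_sub_add_norm_sub (y (j + 1)) (y (j + 2 * d + 1))
            (y (j + 2 * d + 1 + 1))]
    · have h := (((hL.comp (tendsto_add_atTop_nat 1)).sub_const L).sqrt).const_mul 2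
      simpa using h
  obtain ⟨l, hl⟩ := cauchySeq_tendsto_of_complete hcauchy
  have hlW : ∀ n, l ∈ W n := by
    intro n
    have hsub : Tendsto (fun k => n + 2 * k) atTop atTop :=
      tendsto_atTop_mono (fun k => show k ≤ n + 2 * k by omega) tendsto_id
    exact (hclosed n).mem_of_tendsto (hl.comp hsub)
      (Eventually.of_forall fun k => alternating_mem hW hmem n k)
  have hyl : ∀ n, ⟪y n, l⟫ = 0 := by
    intro n
    induction n with
    | zero => exact hstart l hlW
    | succ n ih =>
      have h := horth n l (hlW n)
      rw [inner_sub_left, ih] at h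
      linarith
  have hll : ⟪l, l⟫ = 0 :=
    tendsto_nhds_unique (hl.inner tendsto_const_nhds) (by simp [hyl])
  rw [inner_self_eq_zero.mp hll] at hl
  exact (tendsto_add_atTop_iff_nat 1).mp hl

end AlternatingProjections

/-- von Neumann alternating projections between two closed affine subspaces of a
real Hilbert space converge in norm to the projection of the starting point onto
the intersection. -/
theorem alternating_projections_two_affine_converge
    {H : Type*} [NormedAddCommGroup H] [InnerProductSpace ℝ H] [CompleteSpace H]
    (A1 A2 : AffineSubspace ℝ H)
    (h1 : IsClosed (A1 : Set H)) (h2 : IsClosed (A2 : Set H))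
    (hne : ((A1 : Set H) ∩ (A2 : Set H)).Nonempty)
    -- `P S` is the metric (orthogonal) projection onto a closed convex nonempty set `S`
    (P : Set H → H → H)
    (hP : ∀ S : Set H, IsClosed S → Convex ℝ S → S.Nonempty →
      ∀ v : H, P S v ∈ S ∧ ∀ w ∈ S, ‖P S v - v‖ ≤ ‖w - v‖)
    (xhat : H) (x : ℕ → H) (hx0 : x 0 = xhat)
    (hodd : ∀ n : ℕ, x (2 * n + 1) = P (A1 : Set H) (x (2 * n)))
    (heven : ∀ n : ℕ, x (2 * n + 2) = P (A2 : Set H) (x (2 * n + 1))) :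
    Tendsto x atTop (nhds (P ((A1 : Set H) ∩ (A2 : Set H)) xhat)) := by
  set p := P ((A1 : Set H) ∩ (A2 : Set H)) xhat
  have hproj : ∀ A : AffineSubspace ℝ H, IsClosed (A : Set H) → (A : Set H).Nonempty →
      ∀ v, P (A : Set H) v ∈ A ∧ ∀ d ∈ A.direction, ⟪v - P (A : Set H) v, d⟫ = 0 := by
    intro A hA hAne v
    obtain ⟨hmem, hmin⟩ := hP A hA A.convex hAne v
    exact ⟨hmem, fun d hd => AffineSubspace.inner_sub_eq_zero_of_forall_norm_le hmem hmin hd⟩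
  obtain ⟨hpmem, hpmin⟩ := hP _ (h1.inter h2) (A1.convex.inter A2.convex) hne xhat
  have hp1 : p ∈ A1 := hpmem.1
  have hp2 : p ∈ A2 := hpmem.2
  have hproj1 := hproj A1 h1 (hne.mono Set.inter_subset_left)
  have hproj2 := hproj A2 h2 (hne.mono Set.inter_subset_right)
  have hlim : Tendsto (fun n => x n - p) atTop (𝓝 0) := by
    refine alternating_tendsto_zero
      (W := fun n => if Even n then A1.direction else A2.direction) ?_ ?_ ?_ ?_ ?_
    · intro n
      simp [Nat.even_add]
    · intro n
      split_ifs
      · exact A1.isClosed_direction_iff.mpr h1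
      · exact A2.isClosed_direction_iff.mpr h2
    · intro n
      obtain ⟨k, rfl | rfl⟩ := n.even_or_odd'
      · simpa [hodd] using A1.vsub_mem_direction (hproj1 (x (2 * k))).1 hp1
      · simpa [heven] using A2.vsub_mem_direction (hproj2 (x (2 * k + 1))).1 hp2
    · intro n w hw
      rw [sub_sub_sub_cancel_right]
      obtain ⟨k, rfl | rfl⟩ := n.even_or_odd'
      · rw [hodd]
        exact (hproj1 _).2 w (by simpa using hw)
      · rw [heven]
        exact (hproj2 _).2 w (by simpa using hw)
    · intro w hw
      rw [hx0]
      refine AffineSubspace.inner_sub_eq_zero_of_forall_norm_le (A := A1 ⊓ A2) hpmem hpmin ?_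
      rw [AffineSubspace.direction_inf_of_mem hp1 hp2]
      exact ⟨by simpa using hw 0, by simpa using hw 1⟩
  simpa using hlim.add_const p
end

section
/- Let H be a Hilbert space and C1,...,Cm closed affine subspaces with C = ∩ C_i ≠ ∅. Then the limit of the cyclic successive orthogonal projection iterates x_n (starting at x̂) exists and equals P_C(x̂); moreover, if all C_i are closed linear subspaces, the composition operator T = P_{C_m}∘⋯∘P_{C_1} satisfies Tⁿ x̂ → P_C(x̂) for every x̂ ∈ H. -/
open Filter Topology

/-- The composition of the orthogonal projections onto `V 0, …, V (n - 1)`, with `V 0` applied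
first. -/
noncomputable def successiveProj {H : Type*} [NormedAddCommGroup H] [InnerProductSpace ℝ H]
    (V : ℕ → Submodule ℝ H) [∀ n, (V n).HasOrthogonalProjection] : ℕ → H →L[ℝ] H
  | 0 => ContinuousLinearMap.id ℝ H
  | n + 1 => (V n).starProjection ∘L successiveProj V n

section successiveProj

variable {H : Type*} [NormedAddCommGroup H] [InnerProductSpace ℝ H]
  (V : ℕ → Submodule ℝ H) [∀ n, (V n).HasOrthogonalProjection]

lemma successiveProj_zero_apply (u : H) : successiveProj V 0 u = u := rfl

lemma successiveProj_succ_apply (n : ℕ) (u : H) :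
    successiveProj V (n + 1) u = (V n).starProjection (successiveProj V n u) := rfl

lemma successiveProj_add_period {m : ℕ} (hV : ∀ n, V (n + m) = V n) (n : ℕ) (u : H) :
    successiveProj V (n + m) u = successiveProj V n (successiveProj V m u) := by
  induction n with
  | zero => simp [successiveProj_zero_apply]
  | succ n ih =>
    rw [Nat.add_right_comm, successiveProj_succ_apply, successiveProj_succ_apply, ih]
    congr! 2
    exact hV n

lemma norm_sq_successiveProj_succ (n : ℕ) (u : H) :
    ‖successiveProj V (n + 1) u - successiveProj V n u‖ ^ 2 =
      ‖successiveProj V n u‖ ^ 2 - ‖successiveProj V (n + 1) u‖ ^ 2 := by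
  have h := (V n).norm_sq_eq_add_norm_sq_starProjection (successiveProj V n u)
  rw [Submodule.starProjection_orthogonal_val] at h
  rw [norm_sub_rev, successiveProj_succ_apply]
  linarith

lemma antitone_norm_successiveProj (u : H) : Antitone fun n => ‖successiveProj V n u‖ := by
  refine antitone_nat_of_succ_le fun n => ?_
  have h := norm_sq_successiveProj_succ V n u
  have h₀ := sq_nonneg ‖successiveProj V (n + 1) u - successiveProj V n u‖
  exact le_of_sq_le_sq (by linarith) (norm_nonneg _)

lemma norm_successiveProj_apply_le (n : ℕ) (u : H) : ‖successiveProj V n u‖ ≤ ‖u‖ :=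
  antitone_norm_successiveProj V u (Nat.zero_le n)

lemma tendsto_successiveProj_succ_sub (u : H) :
    Tendsto (fun n => successiveProj V (n + 1) u - successiveProj V n u) atTop (𝓝 0) := by
  obtain ⟨l, hl⟩ : ∃ l, Tendsto (fun n => ‖successiveProj V n u‖) atTop (𝓝 l) :=
    ⟨_, tendsto_atTop_ciInf (antitone_norm_successiveProj V u)
      ⟨0, by rintro _ ⟨n, rfl⟩; exact norm_nonneg _⟩⟩
  have h : Tendsto (fun n => ‖successiveProj V (n + 1) u - successiveProj V n u‖ ^ 2) atTop
      (𝓝 0) := by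
    simp_rw [norm_sq_successiveProj_succ]
    simpa using (hl.pow 2).sub ((hl.comp (tendsto_add_atTop_nat 1)).pow 2)
  rw [tendsto_zero_iff_norm_tendsto_zero]
  simpa [Real.sqrt_sq] using h.sqrt

lemma tendsto_successiveProj_add_sub (k : ℕ) (u : H) :
    Tendsto (fun n => successiveProj V (n + k) u - successiveProj V n u) atTop (𝓝 0) := by
  induction k with
  | zero => simp
  | succ k ih =>
    have h := ((tendsto_successiveProj_succ_sub V u).comp (tendsto_add_atTop_nat k)).add ih
    simpa [Function.comp_def, add_assoc] using h

lemma successiveProj_apply_of_mem_iInf {u : H} (hu : u ∈ ⨅ n, V n) (n : ℕ) :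
    successiveProj V n u = u := by
  induction n with
  | zero => rfl
  | succ n ih =>
    rw [successiveProj_succ_apply, ih, Submodule.starProjection_eq_self_iff]
    exact (Submodule.mem_iInf V).1 hu n

/-- A fixed point of the composition of the projections onto `V 0, …, V (m - 1)` lies in each of
these subspaces. -/
lemma mem_of_successiveProj_eq_self {m : ℕ} {u : H} (hu : successiveProj V m u = u) :
    ∀ n < m, u ∈ V n := by
  have hnorm : ∀ n ≤ m, ‖successiveProj V n u‖ = ‖u‖ := fun n hn =>
    le_antisymm (norm_successiveProj_apply_le V n u)
      (by simpa [hu] using antitone_norm_successiveProj V u hn)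
  have hstep : ∀ n < m, successiveProj V (n + 1) u = successiveProj V n u := fun n hn => by
    have h := norm_sq_successiveProj_succ V n u
    rw [hnorm n hn.le, hnorm (n + 1) hn, sub_self] at h
    simpa [sub_eq_zero] using h
  have hfix : ∀ n ≤ m, successiveProj V n u = u := fun n => by
    induction n with
    | zero => exact fun _ => rfl
    | succ n ih => exact fun hn => (hstep n hn).trans (ih (Nat.le_of_succ_le hn))
  intro n hn
  rw [← Submodule.starProjection_eq_self_iff]
  simpa [successiveProj_succ_apply, hfix n hn.le] using hfix (n + 1) hn

lemma isClosed_setOf_tendsto_successiveProj_zero :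
    IsClosed {u : H | Tendsto (fun n => successiveProj V n u) atTop (𝓝 0)} := by
  refine isClosed_of_closure_subset fun u hu => ?_
  rw [Set.mem_ofPred_eq, Metric.tendsto_atTop]
  intro ε hε
  obtain ⟨w, hw, hdist⟩ := Metric.mem_closure_iff.1 hu (ε / 2) (half_pos hε)
  obtain ⟨N, hN⟩ := Metric.tendsto_atTop.1 hw (ε / 2) (half_pos hε)
  refine ⟨N, fun n hn => ?_⟩
  have h₁ := hN n hn
  have h₂ := norm_successiveProj_apply_le V n (u - w)
  rw [map_sub] at h₂
  rw [dist_zero_right] at h₁ ⊢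
  rw [dist_eq_norm] at hdist
  linarith [norm_le_norm_sub_add (successiveProj V n u) (successiveProj V n w)]

/-- Halperin's theorem for a periodic sequence of closed subspaces. -/
theorem tendsto_successiveProj [CompleteSpace H] [(⨅ n, V n).HasOrthogonalProjection]
    {m : ℕ} (hm : 0 < m) (hV : ∀ n, V (n + m) = V n) (u : H) :
    Tendsto (fun n => successiveProj V n u) atTop (𝓝 ((⨅ n, V n).starProjection u)) := by
  set M := ⨅ n, V n
  set R : H →L[ℝ] H := successiveProj V m - ContinuousLinearMap.id ℝ H with hR
  have hRM : R.rangeᗮ ≤ M := fun z hz => by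
    have hin : inner ℝ (R z) z = 0 := hz (R z) ⟨z, rfl⟩
    have hfix : successiveProj V m z = z := by
      have h₁ := norm_successiveProj_apply_le V m z
      have h₂ := norm_sub_sq_real (successiveProj V m z) z
      have h₃ : inner ℝ (successiveProj V m z) z = ‖z‖ ^ 2 := by
        rw [← real_inner_self_eq_norm_sq, ← sub_eq_zero, ← inner_sub_left]
        exact hin
      rw [h₃] at h₂
      have h₄ : ‖successiveProj V m z‖ ^ 2 ≤ ‖z‖ ^ 2 := by gcongr
      have h₅ : ‖successiveProj V m z - z‖ ^ 2 = 0 :=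
        le_antisymm (by linarith) (sq_nonneg _)
      simpa [sub_eq_zero] using h₅
    have hper : Function.Periodic V m := hV
    refine (Submodule.mem_iInf V).2 fun n => ?_
    rw [← hper.map_mod_nat n]
    exact mem_of_successiveProj_eq_self V hfix _ (Nat.mod_lt n hm)
  have hzero : Tendsto (fun n => successiveProj V n (u - M.starProjection u)) atTop (𝓝 0) := by
    have hmem : u - M.starProjection u ∈ R.range.topologicalClosure := by
      rw [← Submodule.orthogonal_orthogonal_eq_closure]
      exact Submodule.orthogonal_le hRM (M.sub_starProjection_mem_orthogonal u)
    refine closure_minimal ?_ (isClosed_setOf_tendsto_successiveProj_zero V) hmem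
    rintro _ ⟨w, rfl⟩
    simpa [hR, successiveProj_add_period V hV] using tendsto_successiveProj_add_sub V m w
  have hfix (n : ℕ) := successiveProj_apply_of_mem_iInf V (M.starProjection_apply_mem u) n
  simpa [hfix] using hzero.add_const (M.starProjection u)

end successiveProj

/-- A nearest point to `v` in a translate `S = p + K` of a subspace is the translate of the
orthogonal projection onto `K`. -/
lemma sub_eq_starProjection_of_forall_norm_le {H : Type*} [NormedAddCommGroup H]
    [InnerProductSpace ℝ H] (K : Submodule ℝ H) [K.HasOrthogonalProjection] {S : Set H} {p q v : H}
    (hS : ∀ w, w ∈ S ↔ w - p ∈ K) (hq : q ∈ S) (hmin : ∀ w ∈ S, ‖q - v‖ ≤ ‖w - v‖) :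
    q - p = K.starProjection (v - p) := by
  set r := K.starProjection (v - p)
  have hle : ‖q - v‖ ≤ ‖p + r - v‖ := hmin _ <| (hS _).2 <| by
    rw [add_sub_cancel_left]
    exact K.starProjection_apply_mem (v - p)
  have hin : inner ℝ (q - p - r) (v - p - r) = 0 :=
    K.sub_starProjection_mem_orthogonal (v - p) _
      (K.sub_mem ((hS q).1 hq) (K.starProjection_apply_mem _))
  have h := norm_sub_sq_real (q - p - r) (v - p - r)
  rw [hin, show q - p - r - (v - p - r) = q - v by abel] at h
  rw [show p + r - v = -(v - p - r) by abel, norm_neg] at hle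
  have hsq : ‖q - v‖ ^ 2 ≤ ‖v - p - r‖ ^ 2 := by gcongr
  have h₀ : ‖q - p - r‖ ^ 2 = 0 := le_antisymm (by linarith) (sq_nonneg _)
  simpa [sub_eq_zero] using h₀

lemma List.foldl_ofFn_eq_of_forall_succ {α : Type*} {m : ℕ} (f : Fin m → α → α) (z : ℕ → α)
    (hz : ∀ i : Fin m, z (i + 1) = f i (z i)) :
    (List.ofFn f).foldl (fun w p => p w) (z 0) = z m := by
  induction m generalizing z with
  | zero => simp
  | succ m ih =>
    have h₀ : z 1 = f 0 (z 0) := by simpa using hz 0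
    rw [List.ofFn_succ, List.foldl_cons, ← h₀]
    exact ih (fun i => f i.succ) (fun n => z (n + 1)) fun i => by simpa using hz i.succ

/-- von Neumann–Halperin: cyclic successive orthogonal projections onto closed affine
subspaces `C_1, …, C_m` with nonempty intersection `C` converge to `P_C(x̂)`; moreover,
if all the `C_i` are linear subspaces (contain `0`), the iterates of the composed
projection operator `T = P_{C_m} ∘ ⋯ ∘ P_{C_1}` converge to `P_C(x̂)` for every `x̂`. -/
theorem von_neumann_halperin
    {H : Type*} [NormedAddCommGroup H] [InnerProductSpace ℝ H] [CompleteSpace H]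
    (m : ℕ) (hm : 0 < m) (A : Fin m → AffineSubspace ℝ H)
    (hclosed : ∀ i, IsClosed ((A i : Set H)))
    (hne : (⋂ i, (A i : Set H)).Nonempty)
    -- `P S` is the metric (orthogonal) projection onto a closed convex nonempty set `S`
    (P : Set H → H → H)
    (hP : ∀ S : Set H, IsClosed S → Convex ℝ S → S.Nonempty →
      ∀ v : H, P S v ∈ S ∧ ∀ w ∈ S, ‖P S v - v‖ ≤ ‖w - v‖)
    (xhat : H) (x : ℕ → H) (hx0 : x 0 = xhat)
    (hxit : ∀ s : ℕ, x (s + 1) = P ((A ⟨s % m, Nat.mod_lt s hm⟩ : AffineSubspace ℝ H) : Set H) (x s)) :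
    Tendsto x atTop (nhds (P (⋂ i, (A i : Set H)) xhat)) ∧
    ((∀ i, (0 : H) ∈ A i) →
      ∀ v : H,
        Tendsto
          (fun N : ℕ =>
            ((List.ofFn fun i : Fin m => P ((A i : Set H))).foldl (fun w p => p w))^[N] v)
          atTop (nhds (P (⋂ i, (A i : Set H)) v))) := by
  obtain ⟨p, hp⟩ := hne
  have hpA : ∀ i, p ∈ A i := Set.mem_iInter.1 hp
  have hdirclosed : ∀ i, IsClosed ((A i).direction : Set H) := fun i =>
    (AffineSubspace.isClosed_direction_iff (A i)).2 (hclosed i)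
  have hmem : ∀ i w, w ∈ (A i : Set H) ↔ w - p ∈ (A i).direction := fun i w =>
    (AffineSubspace.vsub_right_mem_direction_iff_mem (hpA i) w).symm
  let V : ℕ → Submodule ℝ H := fun n => (A ⟨n % m, Nat.mod_lt n hm⟩).direction
  have hcV : ∀ n, CompleteSpace (V n) := fun n => (hdirclosed _).completeSpace_coe
  have hcM : CompleteSpace (⨅ n, V n : Submodule ℝ H) := by
    have h : IsClosed ((⨅ n, V n : Submodule ℝ H) : Set H) := by
      rw [Submodule.coe_iInf]
      exact isClosed_iInter fun n => hdirclosed _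
    exact h.completeSpace_coe
  have hmemM : ∀ w, w ∈ (⋂ i, (A i : Set H)) ↔ w - p ∈ ⨅ n, V n := fun w => by
    rw [Set.mem_iInter, Submodule.mem_iInf]
    refine ⟨fun h n => (hmem _ w).1 (h _), fun h i => (hmem i w).2 ?_⟩
    simpa [V, Nat.mod_eq_of_lt i.isLt] using h i
  have hPA : ∀ n v, P (A ⟨n % m, Nat.mod_lt n hm⟩ : Set H) v - p =
      (V n).starProjection (v - p) := fun n v => by
    obtain ⟨h₁, h₂⟩ := hP _ (hclosed ⟨n % m, Nat.mod_lt n hm⟩) (AffineSubspace.convex _)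
      ⟨p, hpA _⟩ v
    exact sub_eq_starProjection_of_forall_norm_le (V n) (hmem _) h₁ h₂
  have hPM : ∀ v, P (⋂ i, (A i : Set H)) v - p = (⨅ n, V n).starProjection (v - p) := fun v => by
    obtain ⟨h₁, h₂⟩ := hP _ (isClosed_iInter hclosed)
      (convex_iInter fun i => AffineSubspace.convex _) ⟨p, hp⟩ v
    exact sub_eq_starProjection_of_forall_norm_le _ hmemM h₁ h₂
  have hlim : ∀ z : ℕ → H,
      (∀ s, z (s + 1) = P (A ⟨s % m, Nat.mod_lt s hm⟩ : Set H) (z s)) →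
      Tendsto z atTop (𝓝 (P (⋂ i, (A i : Set H)) (z 0))) := fun z hz => by
    have hz' : ∀ n, successiveProj V n (z 0 - p) = z n - p := fun n => by
      induction n with
      | zero => rfl
      | succ n ih => rw [successiveProj_succ_apply, ih, hz, hPA]
    have h := (tendsto_successiveProj V hm (fun n => by simp [V]) (z 0 - p)).add_const p
    simpa [hz', ← hPM] using h
  refine ⟨hx0 ▸ hlim x hxit, fun _ v => ?_⟩
  let z : ℕ → H := fun n =>
    Nat.rec v (fun s w => P (A ⟨s % m, Nat.mod_lt s hm⟩ : Set H) w) n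
  have hz : ∀ s, z (s + 1) = P (A ⟨s % m, Nat.mod_lt s hm⟩ : Set H) (z s) := fun _ => rfl
  have hiter : ∀ N, ((List.ofFn fun i : Fin m => P ((A i : Set H))).foldl
      (fun w p => p w))^[N] v = z (m * N) := fun N => by
    induction N with
    | zero => rfl
    | succ N ih =>
      rw [Function.iterate_succ_apply', ih]
      refine List.foldl_ofFn_eq_of_forall_succ _ (fun j => z (m * N + j)) fun i => ?_
      rw [← add_assoc, hz]
      simp [Nat.mod_eq_of_lt i.isLt]
  have hsub : Tendsto (fun N => m * N) atTop atTop := tendsto_id.const_mul_atTop' hm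
  simp only [hiter]
  exact (hlim z hz).comp hsub
end
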